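/- The value δ_B(1) of the Ehrhart δ-polynomial of the Lawrence polytope P_B (equal to (d+n−1)! times the normalized volume of P_B) satisfies δ_B(1) = Σ_{F ∈ M_B} #(BOX(F) ∩ ℤ^d) · V_F, where V_F is the number of elements of M_F of maximal dimension codim F. -/

import Mathlib

open scoped BigOperators Pointwise
open Polynomial

noncomputable section

namespace LawrencePaper

attribute [local instance] Classical.propDecidable

/-- The real vector associated to an integer vector. -/
def toR (d : ℕ) (v : Fin d → ℤ) : Fin d → ℝ := fun j => (v j : ℝ)

/-- The `i`-th standard basis vector of `ℝ^n`. -/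
def e (n : ℕ) (i : Fin n) : Fin n → ℝ := Pi.single i 1

/-- The Lawrence polytope of the configuration `b`: the convex hull of the points
`(b i, e i)` and `(0, e i)`. -/
def lawrencePolytope (d n : ℕ) (b : Fin n → Fin d → ℤ) : Set ((Fin d → ℝ) × (Fin n → ℝ)) :=
  convexHull ℝ
    ((Set.range fun i => (toR d (b i), e n i)) ∪
      (Set.range fun i => ((0 : Fin d → ℝ), e n i)))

/-- The number of lattice points in the `m`-th dilate of `P`. -/
def latticeCount (d n : ℕ) (P : Set ((Fin d → ℝ) × (Fin n → ℝ))) (m : ℕ) : ℕ :=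
  Nat.card {z : (Fin d → ℤ) × (Fin n → ℤ) |
    (toR d z.1, fun j => (z.2 j : ℝ)) ∈ (m : ℝ) • P}

/-- `δ` is the Ehrhart δ-polynomial of the `(d+n-1)`-dimensional polytope `P ⊆ ℝ^{d+n}`:
it has degree at most `n+d-1` and satisfies
`(1-t)^{n+d} * Σ_{m ≥ 0} f_P(m) t^m = δ(t)` as formal power series. -/
def IsDeltaPoly (d n : ℕ) (P : Set ((Fin d → ℝ) × (Fin n → ℝ))) (δ : Polynomial ℤ) : Prop :=
  δ.natDegree ≤ n + d - 1 ∧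
    (1 - PowerSeries.X) ^ (n + d) *
      PowerSeries.mk (fun m => (latticeCount d n P m : ℤ)) = (δ : PowerSeries ℤ)

/-- Membership in the matroid `M_B`: the index set `F` corresponds to a linearly
independent subset of the configuration. -/
def memMatroid (d n : ℕ) (b : Fin n → Fin d → ℤ) (F : Finset (Fin n)) : Prop :=
  LinearIndependent ℝ (fun i : F => toR d (b i.1))

/-- The linear span of the vectors indexed by `F`. -/
def spanF (d n : ℕ) (b : Fin n → Fin d → ℤ) (F : Finset (Fin n)) : Submodule ℝ (Fin d → ℝ) :=
  Submodule.span ℝ ((fun i => toR d (b i)) '' F)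

/-- The dimension of an element `F` of the matroid: the dimension of its span. -/
def dimF (d n : ℕ) (b : Fin n → Fin d → ℤ) (F : Finset (Fin n)) : ℕ :=
  Module.finrank ℝ (spanF d n b F)

/-- `BOX(F) = { Σ_{i ∈ F} α_i b_i  :  0 < α_i < 1 }`; `BOX(∅) = {0}`. -/
def box (d n : ℕ) (b : Fin n → Fin d → ℤ) (F : Finset (Fin n)) : Set (Fin d → ℝ) :=
  {x | ∃ α : Fin n → ℝ, (∀ i ∈ F, 0 < α i ∧ α i < 1) ∧ x = ∑ i ∈ F, α i • toR d (b i)}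

/-- The number of lattice points in `BOX(F)`. -/
def boxCount (d n : ℕ) (b : Fin n → Fin d → ℤ) (F : Finset (Fin n)) : ℕ :=
  Nat.card {z : Fin d → ℤ | toR d z ∈ box d n b F}

/-- Membership in the restricted matroid `M_F`: the index set `G` corresponds to a linearly
independent subset of the induced configuration `B_F` in `ℝ^d / Span F`. -/
def memMatroidRes (d n : ℕ) (b : Fin n → Fin d → ℤ) (F G : Finset (Fin n)) : Prop :=
  (∀ i ∈ G, toR d (b i) ∉ spanF d n b F) ∧
    LinearIndependent ℝ (fun i : G => (spanF d n b F).mkQ (toR d (b i.1)))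

/-- The dimension of an element `G` of the restricted matroid `M_F`: the dimension of the
span of the corresponding vectors in `ℝ^d / Span F`. -/
def dimRes (d n : ℕ) (b : Fin n → Fin d → ℤ) (F G : Finset (Fin n)) : ℕ :=
  Module.finrank ℝ (Submodule.span ℝ ((fun i => (spanF d n b F).mkQ (toR d (b i))) '' G))

/-- `f_i`: the number of elements of the restricted matroid `M_F` of dimension `i`. -/
def fRes (d n : ℕ) (b : Fin n → Fin d → ℤ) (F : Finset (Fin n)) (i : ℕ) : ℕ :=
  Nat.card {G : Finset (Fin n) | memMatroidRes d n b F G ∧ dimRes d n b F G = i}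

/-- The `h`-polynomial `h_F(t) = Σ_{i=0}^{codim F} f_i t^i (1-t)^{codim F - i}` of `M_F`. -/
def hPoly (d n : ℕ) (b : Fin n → Fin d → ℤ) (F : Finset (Fin n)) : Polynomial ℤ :=
  ∑ i ∈ Finset.range (d - dimF d n b F + 1),
    C (fRes d n b F i : ℤ) * X ^ i * (1 - X) ^ (d - dimF d n b F - i)

/-- The hyperplane `H_i = {u : ⟨u, b_i⟩ = r_i}`. -/
def hyperplane (d n : ℕ) (b : Fin n → Fin d → ℤ) (r : Fin n → ℝ) (i : Fin n) :
    Set (Fin d → ℝ) :=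
  {u | ∑ j, u j * (b i j : ℝ) = r i}

/-- The arrangement `H` is simple: the intersection of any `l` of the hyperplanes is
either empty or has codimension `l`. -/
def Simple (d n : ℕ) (b : Fin n → Fin d → ℤ) (r : Fin n → ℝ) : Prop :=
  ∀ s : Finset (Fin n), (⋂ i ∈ s, hyperplane d n b r i) = ∅ ∨
    ∀ x ∈ ⋂ i ∈ s, hyperplane d n b r i,
      Module.finrank ℝ
        (Submodule.span ℝ ((fun u => u - x) '' ⋂ i ∈ s, hyperplane d n b r i)) + s.card = d

/-- The affine subspace `A_F = ⋂_{i ∈ F} H_i`. -/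
def flat (d n : ℕ) (b : Fin n → Fin d → ℤ) (r : Fin n → ℝ) (F : Finset (Fin n)) :
    Set (Fin d → ℝ) :=
  ⋂ i ∈ F, hyperplane d n b r i

/-- The cell of the restricted arrangement `H^F` containing the point `u ∈ A_F`: all points
of `A_F` satisfying the same relations `<`, `=`, `>` as `u` with respect to each hyperplane
of `H^F`. -/
def cellOf (d n : ℕ) (b : Fin n → Fin d → ℤ) (r : Fin n → ℝ) (F : Finset (Fin n))
    (u : Fin d → ℝ) : Set (Fin d → ℝ) :=
  {v ∈ flat d n b r F | ∀ i : Fin n, toR d (b i) ∉ spanF d n b F →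
    (((∑ j, v j * (b i j : ℝ)) < r i ↔ (∑ j, u j * (b i j : ℝ)) < r i) ∧
      ((∑ j, v j * (b i j : ℝ)) = r i ↔ (∑ j, u j * (b i j : ℝ)) = r i))}

/-- `f^bd_k`: the number of bounded cells of the restricted arrangement `H^F` of dimension
`k` (the dimension of a cell being the dimension of its affine span). -/
def fBd (d n : ℕ) (b : Fin n → Fin d → ℤ) (r : Fin n → ℝ) (F : Finset (Fin n)) (k : ℕ) : ℕ :=
  Nat.card {Cs : Set (Fin d → ℝ) | (∃ u ∈ flat d n b r F, Cs = cellOf d n b r F u) ∧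
    Bornology.IsBounded Cs ∧ Module.finrank ℝ (vectorSpan ℝ Cs) = k}

/-- `h^bd_F(t) = Σ_{i=0}^{codim F} f^bd_i (t-1)^i`. -/
def hBdPoly (d n : ℕ) (b : Fin n → Fin d → ℤ) (r : Fin n → ℝ) (F : Finset (Fin n)) :
    Polynomial ℤ :=
  ∑ i ∈ Finset.range (d - dimF d n b F + 1), C (fBd d n b r F i : ℤ) * (X - 1) ^ i

/-- The complement within `A_F` of the union of the hyperplanes of `H^F`. -/
def arrComplement (d n : ℕ) (b : Fin n → Fin d → ℤ) (r : Fin n → ℝ) (F : Finset (Fin n)) :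
    Set (Fin d → ℝ) :=
  flat d n b r F \ ⋃ i ∈ {i : Fin n | toR d (b i) ∉ spanF d n b F}, hyperplane d n b r i

/-- `R^bd_F`: the number of bounded regions (connected components of the complement within
`A_F` of the union of the hyperplanes) of the restricted arrangement `H^F`. -/
def boundedRegionCount (d n : ℕ) (b : Fin n → Fin d → ℤ) (r : Fin n → ℝ)
    (F : Finset (Fin n)) : ℕ :=
  Nat.card {R : Set (Fin d → ℝ) | (∃ x ∈ arrComplement d n b r F,
    R = connectedComponentIn (arrComplement d n b r F) x) ∧ Bornology.IsBounded R}

/-- `F` is a maximal linearly independent subset of the configuration. -/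
def IsMaximalIndep (d n : ℕ) (b : Fin n → Fin d → ℤ) (F : Finset (Fin n)) : Prop :=
  memMatroid d n b F ∧ ∀ G : Finset (Fin n), memMatroid d n b G → F ⊆ G → F = G

/-- The matroid `M_B` is coloop free: no element of the configuration lies in every
maximal linearly independent subset. -/
def ColoopFree (d n : ℕ) (b : Fin n → Fin d → ℤ) : Prop :=
  ∀ i : Fin n, ∃ F : Finset (Fin n), IsMaximalIndep d n b F ∧ i ∉ F

/-- `f_i`: the number of elements of the matroid `M_B` of dimension `i`. -/
def fMat (d n : ℕ) (b : Fin n → Fin d → ℤ) (i : ℕ) : ℕ :=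
  Nat.card {F : Finset (Fin n) | memMatroid d n b F ∧ dimF d n b F = i}


section RelativeZonotope

variable {A V ι : Type*} [AddCommGroup A] [AddCommGroup V] [Module ℝ V] [Fintype ι]

/-- The Minkowski sum of the subspace `W` and the zonotope `∑ i, [0, a i] • v i`. -/
def relZonotope (W : Submodule ℝ V) (v : ι → V) (a : ι → ℝ) : Set V :=
  {x | ∃ t : ι → ℝ, (∀ i, 0 ≤ t i ∧ t i ≤ a i) ∧ x - ∑ i, t i • v i ∈ W}

theorem relZonotope_add_mem_iff {W : Submodule ℝ V} {v : ι → V} {a : ι → ℝ} {x w : V}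
    (hw : w ∈ W) : x + w ∈ relZonotope W v a ↔ x ∈ relZonotope W v a := by
  refine exists_congr fun t => and_congr_right fun _ => ?_
  rw [show x + w - ∑ i, t i • v i = (x - ∑ i, t i • v i) + w by abel]
  exact W.add_mem_iff_left hw

theorem convex_relZonotope (W : Submodule ℝ V) (v : ι → V) (a : ι → ℝ) :
    Convex ℝ (relZonotope W v a) := by
  rintro x ⟨t, ht, hx⟩ y ⟨s, hs, hy⟩ p q hp hq hpq
  refine ⟨fun i => p * t i + q * s i, fun i => ⟨?_, ?_⟩, ?_⟩
  · have := (ht i).1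
    have := (hs i).1
    positivity
  · calc p * t i + q * s i ≤ p * a i + q * a i :=
          add_le_add (mul_le_mul_of_nonneg_left (ht i).2 hp)
            (mul_le_mul_of_nonneg_left (hs i).2 hq)
      _ = a i := by rw [← add_mul, hpq, one_mul]
  · have := W.add_mem (W.smul_mem p hx) (W.smul_mem q hy)
    convert this using 1
    simp only [add_smul, mul_smul, Finset.sum_add_distrib, ← Finset.smul_sum, smul_sub]
    abel

theorem mem_relZonotope_add_single [DecidableEq ι] {W : Submodule ℝ V} {v : ι → V} {a : ι → ℝ}
    (ha : ∀ i, 0 ≤ a i) (i : ι) {x : V} :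
    x ∈ relZonotope W v (a + Pi.single i 1) ↔
      ∃ u : ℝ, 0 ≤ u ∧ u ≤ 1 ∧ x - u • v i ∈ relZonotope W v a := by
  constructor
  · rintro ⟨t, ht, hx⟩
    have hti := ht i
    simp only [Pi.add_apply, Pi.single_eq_same] at hti
    refine ⟨t i - min (t i) (a i), by simp, ?_, Function.update t i (min (t i) (a i)), ?_, ?_⟩
    · rcases min_cases (t i) (a i) with h | h <;> linarith
    · intro j
      rcases eq_or_ne j i with rfl | hj
      · simpa using ⟨hti.1, ha j⟩
      · simpa [hj] using ht j
    · convert hx using 1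
      rw [← Finset.add_sum_erase _ _ (Finset.mem_univ i),
        ← Finset.add_sum_erase _ (fun j => t j • v j) (Finset.mem_univ i),
        Finset.sum_congr rfl (g := fun j => t j • v j)
          (fun j hj => by rw [Function.update_of_ne (Finset.ne_of_mem_erase hj)])]
      simp only [Function.update_self, sub_smul]
      abel
  · rintro ⟨u, hu0, hu1, t, ht, hx⟩
    refine ⟨t + Pi.single i u, fun j => ?_, ?_⟩
    · rcases eq_or_ne j i with rfl | hj
      · simp only [Pi.add_apply, Pi.single_eq_same]
        exact ⟨add_nonneg (ht j).1 hu0, add_le_add (ht j).2 hu1⟩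
      · simpa [hj] using ht j
    · convert hx using 1
      simp only [Pi.add_apply, add_smul, Finset.sum_add_distrib]
      rw [Finset.sum_eq_single i (f := fun j => (Pi.single i u : ι → ℝ) j • v j)
        (fun j _ hj => by simp [hj]) (by simp)]
      simp only [Pi.single_eq_same]
      abel

theorem mem_relZonotope_sup_span {W : Submodule ℝ V} {v : ι → V} {a : ι → ℝ} {w x : V} :
    x ∈ relZonotope (W ⊔ Submodule.span ℝ {w}) v a ↔
      ∃ s : ℝ, x + s • w ∈ relZonotope W v a := by
  constructor
  · rintro ⟨t, ht, hx⟩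
    obtain ⟨y, hy, z, hz, hyz⟩ := Submodule.mem_sup.1 hx
    obtain ⟨c, rfl⟩ := Submodule.mem_span_singleton.1 hz
    refine ⟨-c, t, ht, ?_⟩
    convert hy using 1
    rw [neg_smul, add_sub_right_comm, ← hyz]
    abel
  · rintro ⟨s, t, ht, hx⟩
    refine ⟨t, ht, Submodule.mem_sup.2 ⟨_, hx, -(s • w),
      neg_mem (Submodule.smul_mem _ _ (Submodule.mem_span_singleton_self w)), ?_⟩⟩
    abel

theorem relZonotope_line_bddAbove {W : Submodule ℝ V} (v : ι → V) (a : ι → ℝ) {w : V}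
    (hw : w ∉ W) (x : V) : ∃ C : ℝ, ∀ s : ℝ, x + s • w ∈ relZonotope W v a → s ≤ C := by
  obtain ⟨f, hf, hW⟩ := Submodule.exists_le_ker_of_notMem hw
  refine ⟨(∑ i, a i * |(f w)⁻¹ * f (v i)|) - (f w)⁻¹ * f x, ?_⟩
  rintro s ⟨t, ht, hx⟩
  have h0 : f (x + s • w - ∑ i, t i • v i) = 0 := hW hx
  simp only [map_sub, map_add, map_smul, map_sum, smul_eq_mul] at h0
  have h1 : s = (∑ i, t i * ((f w)⁻¹ * f (v i))) - (f w)⁻¹ * f x := by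
    have : ∑ i, t i * ((f w)⁻¹ * f (v i)) = (f w)⁻¹ * ∑ i, t i * f (v i) := by
      rw [Finset.mul_sum]
      exact Finset.sum_congr rfl fun i _ => by ring
    rw [this]
    field_simp
    linarith
  rw [h1]
  refine sub_le_sub_right (Finset.sum_le_sum fun i _ => ?_) _
  calc t i * ((f w)⁻¹ * f (v i)) ≤ t i * |(f w)⁻¹ * f (v i)| :=
        mul_le_mul_of_nonneg_left (le_abs_self _) (ht i).1
    _ ≤ _ := mul_le_mul_of_nonneg_right (ht i).2 (abs_nonneg _)

/-- Along a line in a direction outside `W`, enlarging the zonotope by a unit segment in that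
direction adds exactly one point of every unit lattice on the line. -/
theorem existsUnique_int_line [DecidableEq ι] {W : Submodule ℝ V} {v : ι → V} {a : ι → ℝ}
    (ha : ∀ i, 0 ≤ a i) {i : ι} (hi : v i ∉ W) {x : V}
    (hx : x ∈ relZonotope (W ⊔ Submodule.span ℝ {v i}) v a) :
    ∃! k : ℤ, x + (k : ℝ) • v i ∈ relZonotope W v (a + Pi.single i 1) \ relZonotope W v a := by
  set S : Set ℝ := {s | x + s • v i ∈ relZonotope W v a} with hS
  have hconv : S.OrdConnected := by
    rw [← convex_iff_ordConnected]
    intro s hs t ht p q hp hq hpq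
    have := convex_relZonotope W v a hs ht hp hq hpq
    rw [hS, Set.mem_ofPred_eq]
    convert this using 1
    have hx' : x = p • x + q • x := by rw [← add_smul, hpq, one_smul]
    nth_rewrite 1 [hx']
    simp only [smul_add, add_smul, smul_eq_mul, mul_smul]
    abel
  have key : ∀ k : ℤ, x + (k : ℝ) • v i ∈ relZonotope W v (a + Pi.single i 1) ↔
      ∃ u : ℝ, 0 ≤ u ∧ u ≤ 1 ∧ (k : ℝ) - u ∈ S := by
    intro k
    rw [mem_relZonotope_add_single ha]
    simp only [hS, Set.mem_ofPred_eq, sub_smul, add_sub_assoc]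
  obtain ⟨s, hs⟩ := mem_relZonotope_sup_span.1 hx
  obtain ⟨C, hC⟩ := relZonotope_line_bddAbove v a hi x
  obtain ⟨k, hk, hmax⟩ := Int.exists_greatest_of_bdd
    (P := fun k : ℤ => ∃ u : ℝ, 0 ≤ u ∧ u ≤ 1 ∧ (k : ℝ) - u ∈ S)
    ⟨⌈C + 1⌉, fun z ⟨u, _, hu1, hz⟩ => by
      have h1 := hC _ hz
      have h2 := Int.le_ceil (C + 1)
      exact_mod_cast (by linarith : (z : ℝ) ≤ ⌈C + 1⌉)⟩
    ⟨⌈s⌉, ⌈s⌉ - s, by linarith [Int.le_ceil s], by linarith [Int.ceil_lt_add_one s],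
      by rwa [sub_sub_cancel]⟩
  have hkS : (k : ℝ) ∉ S := fun h => by
    have := hmax (k + 1) ⟨1, zero_le_one, le_rfl, by simpa using h⟩
    omega
  refine ⟨k, ⟨(key k).2 hk, hkS⟩, ?_⟩
  rintro l ⟨hl, hlS⟩
  have hl' := (key l).1 hl
  by_contra hne
  have hlt : l + 1 ≤ k := (lt_of_le_of_ne (hmax l hl') hne)
  have hlt' : (l : ℝ) + 1 ≤ k := by exact_mod_cast hlt
  obtain ⟨u, hu0, hu1, hu⟩ := hk
  obtain ⟨u', hu0', hu1', hu'⟩ := hl'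
  exact hlS (hconv.out hu' hu ⟨by linarith, by linarith⟩)

variable (φ : A →+ V) (L : AddSubgroup A) (W : Submodule ℝ V) (v : ι → V) (a : ι → ℝ)

/-- The classes modulo `L` of the points of `A` that `φ` maps into `relZonotope W v a`. -/
def zonotopeClasses : Set (A ⧸ L) :=
  (QuotientAddGroup.mk : A → A ⧸ L) '' (φ ⁻¹' relZonotope W v a)

variable {φ L W v a}

theorem mk_mem_zonotopeClasses (hL : ∀ x ∈ L, φ x ∈ W) {x : A} :
    (x : A ⧸ L) ∈ zonotopeClasses φ L W v a ↔ φ x ∈ relZonotope W v a := by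
  constructor
  · rintro ⟨y, hy, hyx⟩
    have h := hL _ (QuotientAddGroup.eq.1 hyx)
    have h' := (relZonotope_add_mem_iff h).2 hy
    simpa using h'
  · exact fun h => ⟨x, h, rfl⟩

theorem zonotopeClasses_add_single_of_mem [DecidableEq ι] (ha : ∀ i, 0 ≤ a i) {i : ι}
    (hi : v i ∈ W) :
    zonotopeClasses φ L W v (a + Pi.single i 1) = zonotopeClasses φ L W v a := by
  unfold zonotopeClasses
  congr 2
  ext x
  rw [mem_relZonotope_add_single ha]
  constructor
  · rintro ⟨u, -, -, h⟩
    rw [sub_eq_add_neg] at h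
    exact (relZonotope_add_mem_iff (neg_mem (W.smul_mem u hi))).1 h
  · exact fun h => ⟨0, le_rfl, zero_le_one, by simpa using h⟩

theorem zonotopeClasses_add_single_of_notMem [DecidableEq ι] (hL : ∀ x ∈ L, φ x ∈ W)
    (ha : ∀ i, 0 ≤ a i) {i : ι} (hi : v i ∉ W) {β : A} (hβ : φ β = v i)
    (h₁ : (zonotopeClasses φ L W v a).Finite)
    (h₂ : (zonotopeClasses φ (L ⊔ AddSubgroup.zmultiples β)
      (W ⊔ Submodule.span ℝ {v i}) v a).Finite) :
    (zonotopeClasses φ L W v (a + Pi.single i 1)).Finite ∧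
      (zonotopeClasses φ L W v (a + Pi.single i 1)).ncard =
        (zonotopeClasses φ L W v a).ncard +
          (zonotopeClasses φ (L ⊔ AddSubgroup.zmultiples β)
            (W ⊔ Submodule.span ℝ {v i}) v a).ncard := by
  have hsub : zonotopeClasses φ L W v a ⊆ zonotopeClasses φ L W v (a + Pi.single i 1) := by
    refine Set.image_mono fun x hx => ?_
    rw [Set.mem_preimage, mem_relZonotope_add_single ha]
    exact ⟨0, le_rfl, zero_le_one, by simpa using hx⟩
  have hL' : ∀ x ∈ L ⊔ AddSubgroup.zmultiples β, φ x ∈ W ⊔ Submodule.span ℝ {v i} := by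
    intro x hx
    obtain ⟨y, hy, z, hz, rfl⟩ := AddSubgroup.mem_sup.1 hx
    obtain ⟨k, rfl⟩ := AddSubgroup.mem_zmultiples_iff.1 hz
    rw [map_add, map_zsmul, hβ]
    exact Submodule.add_mem_sup (hL y hy)
      (zsmul_mem (Submodule.mem_span_singleton_self _) k)
  have hmem : ∀ x : A, (x : A ⧸ L) ∈ zonotopeClasses φ L W v (a + Pi.single i 1) \
      zonotopeClasses φ L W v a ↔
        φ x ∈ relZonotope W v (a + Pi.single i 1) \ relZonotope W v a := by
    intro x
    rw [Set.mem_sdiff, Set.mem_sdiff, mk_mem_zonotopeClasses hL, mk_mem_zonotopeClasses hL]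
  have hup : ∀ x : A, φ x ∈ relZonotope W v (a + Pi.single i 1) →
      φ x ∈ relZonotope (W ⊔ Submodule.span ℝ {v i}) v a := by
    intro x hx
    obtain ⟨u, -, -, h⟩ := (mem_relZonotope_add_single ha i).1 hx
    exact mem_relZonotope_sup_span.2 ⟨-u, by simpa [sub_eq_add_neg] using h⟩
  let π : A ⧸ L → A ⧸ (L ⊔ AddSubgroup.zmultiples β) :=
    QuotientAddGroup.map L (L ⊔ AddSubgroup.zmultiples β) (AddMonoidHom.id A)
      (le_sup_left)
  have hbij : Set.BijOn π (zonotopeClasses φ L W v (a + Pi.single i 1) \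
      zonotopeClasses φ L W v a) (zonotopeClasses φ (L ⊔ AddSubgroup.zmultiples β)
      (W ⊔ Submodule.span ℝ {v i}) v a) := by
    refine ⟨?_, ?_, ?_⟩
    · intro q hq
      obtain ⟨x, rfl⟩ := QuotientAddGroup.mk_surjective q
      exact (mk_mem_zonotopeClasses hL').2 (hup x ((hmem x).1 hq).1)
    · intro q hq r hr hqr
      obtain ⟨x, rfl⟩ := QuotientAddGroup.mk_surjective q
      obtain ⟨y, rfl⟩ := QuotientAddGroup.mk_surjective r
      have hxy : -x + y ∈ L ⊔ AddSubgroup.zmultiples β := QuotientAddGroup.eq.1 hqr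
      obtain ⟨l, hl, z, hz, hlz⟩ := AddSubgroup.mem_sup.1 hxy
      obtain ⟨k, rfl⟩ := AddSubgroup.mem_zmultiples_iff.1 hz
      have hx := (hmem x).1 hq
      have hy := (hmem y).1 hr
      have hyx : φ y = φ x + (k : ℝ) • v i + φ l := by
        have : y = x + k • β + l := by
          rw [add_assoc, add_comm (k • β), hlz]
          abel
        rw [this, map_add, map_add, map_zsmul, hβ, Int.cast_smul_eq_zsmul]
      have h := (existsUnique_int_line ha hi (hup x hx.1)).unique (y₁ := 0) (y₂ := k)
        (by simpa using hx) (by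
          rw [hyx, Set.mem_sdiff, relZonotope_add_mem_iff (hL l hl),
            relZonotope_add_mem_iff (hL l hl)] at hy
          exact hy)
      refine QuotientAddGroup.eq.2 ?_
      rw [← hlz, ← h]
      simpa using hl
    · intro q hq
      obtain ⟨x, rfl⟩ := QuotientAddGroup.mk_surjective q
      obtain ⟨k, hk, -⟩ := existsUnique_int_line ha hi ((mk_mem_zonotopeClasses hL').1 hq)
      refine ⟨((x + k • β : A) : A ⧸ L), (hmem _).2 ?_, ?_⟩
      · rwa [map_add, map_zsmul, hβ, ← Int.cast_smul_eq_zsmul ℝ]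
      · refine QuotientAddGroup.eq.2 ?_
        simp only [AddMonoidHom.id_apply, neg_add_rev, add_assoc, neg_add_cancel, add_zero]
        exact neg_mem (AddSubgroup.mem_sup_right (zsmul_mem (AddSubgroup.mem_zmultiples β) k))
  have hdiff := hbij.finite_iff_finite.2 h₂
  have hfin : (zonotopeClasses φ L W v (a + Pi.single i 1)).Finite :=
    (hdiff.union h₁).subset fun q hq => by
      by_cases h : q ∈ zonotopeClasses φ L W v a
      · exact Or.inr h
      · exact Or.inl ⟨hq, h⟩
  refine ⟨hfin, ?_⟩
  rw [← Set.ncard_sdiff_add_ncard_of_subset hsub hfin, ← hbij.image_eq,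
    hbij.injOn.ncard_image, add_comm]

end RelativeZonotope

section Lawrence

variable {d n : ℕ} {b : Fin n → Fin d → ℤ}

/-- The embedding of `ℤ^d` into `ℝ^d`. -/
def toRHom (d : ℕ) : (Fin d → ℤ) →+ (Fin d → ℝ) where
  toFun := toR d
  map_zero' := by ext; simp [toR]
  map_add' x y := by ext; simp [toR]

theorem toRHom_apply (x : Fin d → ℤ) : toRHom d x = toR d x := rfl

/-- The subgroup of `ℤ^d` generated by the vectors indexed by `F`. -/
def latticeF (b : Fin n → Fin d → ℤ) (F : Finset (Fin n)) : AddSubgroup (Fin d → ℤ) :=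
  AddSubgroup.closure (b '' F)

theorem toRHom_mem_spanF {F : Finset (Fin n)} {x : Fin d → ℤ} (hx : x ∈ latticeF b F) :
    toRHom d x ∈ spanF d n b F := by
  have : latticeF b F ≤ (spanF d n b F).toAddSubgroup.comap (toRHom d) := by
    rw [latticeF, AddSubgroup.closure_le]
    rintro _ ⟨i, hi, rfl⟩
    exact Submodule.subset_span ⟨i, hi, rfl⟩
  exact this hx

theorem latticeF_insert (i : Fin n) (F : Finset (Fin n)) :
    latticeF b (insert i F) = latticeF b F ⊔ AddSubgroup.zmultiples (b i) := by
  rw [latticeF, Finset.coe_insert, Set.image_insert_eq, Set.insert_eq, AddSubgroup.closure_union,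
    AddSubgroup.zmultiples_eq_closure, sup_comm, latticeF]

theorem spanF_insert (i : Fin n) (F : Finset (Fin n)) :
    spanF d n b (insert i F) = spanF d n b F ⊔ Submodule.span ℝ {toR d (b i)} := by
  rw [spanF, Finset.coe_insert, Set.image_insert_eq, Submodule.span_insert, sup_comm, spanF]

theorem memMatroid_iff_linearIndepOn {F : Finset (Fin n)} :
    memMatroid d n b F ↔ LinearIndepOn ℝ (fun i => toR d (b i)) (F : Set (Fin n)) :=
  Iff.rfl

theorem memMatroid.subset {F B : Finset (Fin n)} (hB : memMatroid d n b B) (h : F ⊆ B) :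
    memMatroid d n b F :=
  (memMatroid_iff_linearIndepOn.1 hB).mono (Finset.coe_subset.2 h)

theorem memMatroid.coeff_unique {F : Finset (Fin n)} (hF : memMatroid d n b F)
    {α β : Fin n → ℝ}
    (h : ∑ i ∈ F, α i • toR d (b i) = ∑ i ∈ F, β i • toR d (b i)) :
    ∀ i ∈ F, α i = β i := by
  intro i hi
  have := linearIndepOn_finset_iff.1 (memMatroid_iff_linearIndepOn.1 hF) (α - β)
    (by simp [sub_smul, Finset.sum_sub_distrib, h]) i hi
  exact sub_eq_zero.1 this

theorem mem_span_image_finset_iff_exists_sum {R M ι : Type*} [Ring R] [AddCommGroup M]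
    [Module R M] {v : ι → M} {s : Finset ι} {x : M} :
    x ∈ Submodule.span R (v '' s) ↔ ∃ c : ι → R, ∑ i ∈ s, c i • v i = x := by
  rw [Submodule.mem_span_image_finset_iff_exists_fun]
  constructor
  · rintro ⟨c, rfl⟩
    refine ⟨fun i => if h : i ∈ s then c ⟨i, h⟩ else 0, ?_⟩
    rw [← Finset.sum_coe_sort]
    simp
  · rintro ⟨c, rfl⟩
    exact ⟨fun i => c i, Finset.sum_coe_sort s fun i => c i • v i⟩

theorem mem_spanF_iff {F : Finset (Fin n)} {x : Fin d → ℝ} :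
    x ∈ spanF d n b F ↔ ∃ α : Fin n → ℝ, ∑ i ∈ F, α i • toR d (b i) = x :=
  mem_span_image_finset_iff_exists_sum

theorem mem_latticeF_iff {F : Finset (Fin n)} {x : Fin d → ℤ} :
    x ∈ latticeF b F ↔ ∃ k : Fin n → ℤ, ∑ i ∈ F, k i • b i = x := by
  rw [← mem_span_image_finset_iff_exists_sum,
    ← Submodule.mem_toAddSubgroup, Submodule.span_int_eq_addSubgroupClosure]
  rfl

/-- The lattice points of the half-open parallelepiped spanned by the vectors indexed by `F`. -/
def halfOpenPoints (b : Fin n → Fin d → ℤ) (F : Finset (Fin n)) : Set (Fin d → ℤ) :=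
  {z | ∃ α : Fin n → ℝ, (∀ i ∈ F, 0 ≤ α i ∧ α i < 1) ∧ toR d z = ∑ i ∈ F, α i • toR d (b i)}

theorem halfOpenPoints_finite (b : Fin n → Fin d → ℤ) (F : Finset (Fin n)) :
    (halfOpenPoints b F).Finite := by
  refine (Set.finite_Icc (fun j => -∑ i ∈ F, |b i j|) (fun j => ∑ i ∈ F, |b i j|)).subset ?_
  rintro z ⟨α, hα, hz⟩
  have h : ∀ j, |z j| ≤ ∑ i ∈ F, |b i j| := by
    intro j
    have hj := congrFun hz j
    simp only [toR, Finset.sum_apply, Pi.smul_apply, smul_eq_mul] at hj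
    have : |(z j : ℝ)| ≤ ∑ i ∈ F, |(b i j : ℝ)| := by
      rw [hj]
      refine (Finset.abs_sum_le_sum_abs _ _).trans (Finset.sum_le_sum fun i hi => ?_)
      rw [abs_mul, abs_of_nonneg (hα i hi).1]
      exact mul_le_of_le_one_left (abs_nonneg _) (hα i hi).2.le
    exact_mod_cast this
  exact ⟨fun j => (abs_le.1 (h j)).1, fun j => (abs_le.1 (h j)).2⟩

theorem box_subset_halfOpenPoints {F B : Finset (Fin n)} (h : F ⊆ B) :
    {z : Fin d → ℤ | toR d z ∈ box d n b F} ⊆ halfOpenPoints b B := by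
  rintro z ⟨α, hα, hz⟩
  refine ⟨fun i => if i ∈ F then α i else 0, fun i _ => ?_, ?_⟩
  · by_cases hi : i ∈ F
    · simpa [hi] using ⟨(hα i hi).1.le, (hα i hi).2⟩
    · simp [hi]
  · simp only [ite_smul, zero_smul, ← Finset.sum_filter, Finset.filter_mem_eq_inter]
    rw [hz, Finset.inter_eq_right.2 h]

/-- The half-open parallelepiped is the disjoint union of the boxes of the subsets of `B`. -/
theorem ncard_halfOpenPoints {B : Finset (Fin n)} (hB : memMatroid d n b B) :
    (halfOpenPoints b B).ncard = ∑ F ∈ B.powerset, boxCount d n b F := by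
  have hfin : ∀ F ∈ B.powerset, {z : Fin d → ℤ | toR d z ∈ box d n b F}.Finite := fun F hF =>
    (halfOpenPoints_finite b B).subset (box_subset_halfOpenPoints (Finset.mem_powerset.1 hF))
  have hunion : halfOpenPoints b B =
      ⋃ F ∈ (B.powerset : Set (Finset (Fin n))), {z : Fin d → ℤ | toR d z ∈ box d n b F} := by
    refine Set.Subset.antisymm ?_ ?_
    · rintro z ⟨α, hα, hz⟩
      refine Set.mem_biUnion (x := B.filter fun i => α i ≠ 0)
        (Finset.mem_coe.2 (Finset.mem_powerset.2 (Finset.filter_subset _ _))) ?_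
      refine ⟨α, fun i hi => ?_, ?_⟩
      · rw [Finset.mem_filter] at hi
        exact ⟨lt_of_le_of_ne (hα i hi.1).1 (Ne.symm hi.2), (hα i hi.1).2⟩
      · rw [hz, Finset.sum_filter_of_ne]
        rintro i - hi h0
        exact hi (by rw [h0, zero_smul])
    · exact Set.iUnion₂_subset fun F hF =>
        box_subset_halfOpenPoints (Finset.mem_powerset.1 (Finset.mem_coe.1 hF))
  have hdisj : (B.powerset : Set (Finset (Fin n))).PairwiseDisjoint
      fun F => {z : Fin d → ℤ | toR d z ∈ box d n b F} := by
    intro F hF G hG hne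
    refine Set.disjoint_left.2 ?_
    rintro z ⟨α, hα, hz⟩ ⟨β, hβ, hz'⟩
    have hFB := Finset.mem_powerset.1 (Finset.mem_coe.1 hF)
    have hGB := Finset.mem_powerset.1 (Finset.mem_coe.1 hG)
    have h := hB.coeff_unique (α := fun i => if i ∈ F then α i else 0)
      (β := fun i => if i ∈ G then β i else 0) (by
        simp only [ite_smul, zero_smul, ← Finset.sum_filter, Finset.filter_mem_eq_inter]
        rw [Finset.inter_eq_right.2 hFB, Finset.inter_eq_right.2 hGB, ← hz, ← hz'])
    refine hne (Finset.ext fun i => ⟨fun hi => ?_, fun hi => ?_⟩)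
    · by_contra hiG
      have := h i (hFB hi)
      simp only [hi, hiG, if_true, if_false] at this
      exact (hα i hi).1.ne' this
    · by_contra hiF
      have := h i (hGB hi)
      simp only [hi, hiF, if_true, if_false] at this
      exact (hβ i hi).1.ne this
  rw [hunion, Set.Finite.ncard_biUnion (Finset.finite_toSet _) hfin hdisj,
    finsum_mem_coe_finset]
  rfl

/-- The number of classes modulo the lattice spanned by `F` of the lattice points in the real
span of `F`. -/
def latticeIndex (b : Fin n → Fin d → ℤ) (F : Finset (Fin n)) : ℕ :=
  (zonotopeClasses (toRHom d) (latticeF b F) (spanF d n b F) (fun i => toR d (b i)) 0).ncard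

theorem mem_relZonotope_zero {V ι : Type*} [AddCommGroup V] [Module ℝ V] [Fintype ι]
    {W : Submodule ℝ V} {v : ι → V} {x : V} : x ∈ relZonotope W v 0 ↔ x ∈ W := by
  constructor
  · rintro ⟨t, ht, hx⟩
    have : t = 0 := funext fun i => le_antisymm (ht i).2 (ht i).1
    simpa [this] using hx
  · exact fun hx => ⟨0, by simp, by simpa using hx⟩

theorem bijOn_halfOpenPoints {F : Finset (Fin n)} (hF : memMatroid d n b F) :
    Set.BijOn (QuotientAddGroup.mk : _ → (Fin d → ℤ) ⧸ latticeF b F) (halfOpenPoints b F)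
      (zonotopeClasses (toRHom d) (latticeF b F) (spanF d n b F)
        (fun i => toR d (b i)) 0) := by
  have hsum : ∀ k : Fin n → ℤ, toRHom d (∑ i ∈ F, k i • b i) =
      ∑ i ∈ F, (k i : ℝ) • toR d (b i) := fun k => by
    rw [map_sum]
    exact Finset.sum_congr rfl fun i _ => by
      rw [map_zsmul, toRHom_apply, Int.cast_smul_eq_zsmul]
  refine ⟨?_, ?_, ?_⟩
  · rintro z ⟨α, -, hz⟩
    exact ⟨z, mem_relZonotope_zero.2 (mem_spanF_iff.2 ⟨α, hz.symm⟩), rfl⟩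
  · rintro x ⟨α, hα, hx⟩ y ⟨β, hβ, hy⟩ hxy
    obtain ⟨k, hk⟩ := mem_latticeF_iff.1 (QuotientAddGroup.eq.1 hxy)
    have h := hF.coeff_unique (α := fun i => (k i : ℝ)) (β := fun i => β i - α i) (by
      rw [← hsum, hk, map_add, map_neg, toRHom_apply, toRHom_apply, hx, hy]
      simp only [sub_smul, Finset.sum_sub_distrib]
      abel)
    have hk0 : ∀ i ∈ F, k i = 0 := by
      intro i hi
      have h1 := h i hi
      have h2 := hα i hi
      have h3 := hβ i hi
      have h4 : (k i : ℝ) < 1 := by linarith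
      have h5 : (-1 : ℝ) < k i := by linarith
      have h6 : k i < 1 := by exact_mod_cast h4
      have h7 : -1 < k i := by exact_mod_cast h5
      omega
    rw [Finset.sum_eq_zero fun i hi => by rw [hk0 i hi, zero_smul]] at hk
    exact (neg_add_eq_zero.1 hk.symm)
  · rintro _ ⟨x, hx, rfl⟩
    obtain ⟨α, hα⟩ := mem_spanF_iff.1 (mem_relZonotope_zero.1 hx)
    refine ⟨x - ∑ i ∈ F, ⌊α i⌋ • b i, ⟨fun i => Int.fract (α i),
      fun i _ => ⟨Int.fract_nonneg _, Int.fract_lt_one _⟩, ?_⟩, ?_⟩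
    · rw [← toRHom_apply, map_sub, hsum, ← hα, ← Finset.sum_sub_distrib]
      simp only [← sub_smul, Int.self_sub_floor]
    · refine QuotientAddGroup.eq.2 (mem_latticeF_iff.2 ⟨fun i => ⌊α i⌋, ?_⟩)
      abel

theorem latticeIndex_eq_sum_boxCount {B : Finset (Fin n)} (hB : memMatroid d n b B) :
    latticeIndex b B = ∑ F ∈ B.powerset, boxCount d n b F := by
  rw [latticeIndex, ← (bijOn_halfOpenPoints hB).ncard_eq, ncard_halfOpenPoints hB]

/-- The number of lattice classes of a dilated zonotope relative to the span of `F` is a sum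
over the independent sets containing `F`. -/
theorem ncard_zonotopeClasses (a : Fin n → ℕ) {F : Finset (Fin n)} (hF : memMatroid d n b F) :
    (zonotopeClasses (toRHom d) (latticeF b F) (spanF d n b F) (fun i => toR d (b i))
        (fun i => (a i : ℝ))).Finite ∧
      (zonotopeClasses (toRHom d) (latticeF b F) (spanF d n b F) (fun i => toR d (b i))
        (fun i => (a i : ℝ))).ncard =
      ∑ B : Finset (Fin n) with F ⊆ B ∧ memMatroid d n b B,
        latticeIndex b B * ∏ i ∈ B \ F, a i := by
  induction hm : ∑ i, a i generalizing a F with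
  | zero =>
    have ha : a = 0 := funext fun i => (Finset.sum_eq_zero_iff.1 hm) i (Finset.mem_univ i)
    subst ha
    have h0 : (fun i : Fin n => (((0 : Fin n → ℕ) i : ℕ) : ℝ)) = 0 := by ext; simp
    rw [h0]
    refine ⟨(bijOn_halfOpenPoints hF).finite_iff_finite.1 (halfOpenPoints_finite b F), ?_⟩
    rw [Finset.sum_eq_single F]
    · simp [latticeIndex]
    · intro B hB hne
      rw [Finset.mem_filter] at hB
      obtain ⟨i, hi⟩ := Finset.sdiff_nonempty.2 fun h => hne (h.antisymm hB.2.1)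
      rw [Finset.prod_eq_zero hi rfl, mul_zero]
    · simp [hF]
  | succ m ih =>
    obtain ⟨i, -, hi⟩ := Finset.exists_ne_zero_of_sum_ne_zero (hm.trans_ne m.succ_ne_zero)
    obtain ⟨a, rfl⟩ : ∃ a', a = a' + Pi.single i 1 :=
      ⟨a - Pi.single i 1, (tsub_add_cancel_of_le (by
        intro j
        rcases eq_or_ne j i with rfl | hj
        · simpa using Nat.one_le_iff_ne_zero.2 hi
        · simp [hj])).symm⟩
    have hm' : ∑ j, a j = m := by
      simpa [Finset.sum_add_distrib] using hm
    have hcast : (fun j => (((a + Pi.single i 1 : Fin n → ℕ) j : ℕ) : ℝ)) =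
        (fun j => (a j : ℝ)) + Pi.single i 1 := by
      ext j
      rcases eq_or_ne j i with rfl | hj
      · simp
      · simp [hj]
    rw [hcast]
    have ha : ∀ j, (0 : ℝ) ≤ (a j : ℝ) := fun j => Nat.cast_nonneg _
    have hprod_of_notMem : ∀ s : Finset (Fin n), i ∉ s →
        ∏ j ∈ s, (a + Pi.single i 1 : Fin n → ℕ) j = ∏ j ∈ s, a j := fun s hs =>
      Finset.prod_congr rfl fun j hj => by
        have : j ≠ i := fun h => hs (h ▸ hj)
        simp [this]
    by_cases hiW : toR d (b i) ∈ spanF d n b F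
    · rw [zonotopeClasses_add_single_of_mem (v := fun i => toR d (b i)) ha hiW]
      refine ⟨(ih a hF hm').1, ?_⟩
      rw [(ih a hF hm').2]
      refine Finset.sum_congr rfl fun B hB => ?_
      obtain ⟨-, hFB, hB⟩ := Finset.mem_filter.1 hB
      rw [hprod_of_notMem]
      intro hiB
      obtain ⟨hiB, hiF⟩ := Finset.mem_sdiff.1 hiB
      have h := memMatroid_iff_linearIndepOn.1 (hB.subset (Finset.insert_subset hiB hFB))
      rw [Finset.coe_insert, linearIndepOn_insert (by simpa using hiF)] at h
      exact h.2 hiW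
    · have hiF : i ∉ F := fun h => hiW (Submodule.subset_span ⟨i, h, rfl⟩)
      have hFi : memMatroid d n b (insert i F) := by
        rw [memMatroid_iff_linearIndepOn, Finset.coe_insert,
          linearIndepOn_insert (by simpa using hiF)]
        exact ⟨hF, hiW⟩
      have h := zonotopeClasses_add_single_of_notMem (v := fun i => toR d (b i))
        (φ := toRHom d) (L := latticeF b F) (β := b i)
        (fun x hx => toRHom_mem_spanF hx) ha hiW rfl (ih a hF hm').1
        (by rw [← latticeF_insert, ← spanF_insert]; exact (ih a hFi hm').1)
      refine ⟨h.1, ?_⟩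
      rw [h.2, (ih a hF hm').2]
      simp only [← spanF_insert]
      rw [← latticeF_insert, (ih a hFi hm').2]
      have hfilter : (Finset.univ.filter fun B => insert i F ⊆ B ∧ memMatroid d n b B) =
          (Finset.univ.filter fun B => F ⊆ B ∧ memMatroid d n b B).filter fun B => i ∈ B := by
        ext B
        simp only [Finset.mem_filter, Finset.mem_univ, true_and, Finset.insert_subset_iff]
        tauto
      rw [hfilter, Finset.sum_filter (fun B => i ∈ B), ← Finset.sum_add_distrib]
      refine Finset.sum_congr rfl fun B hB => ?_
      split_ifs with hiB
      · rw [← mul_add, Finset.sdiff_insert,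
          ← Finset.mul_prod_erase _ _ (Finset.mem_sdiff.2 ⟨hiB, hiF⟩),
          ← Finset.mul_prod_erase _ (a + Pi.single i 1) (Finset.mem_sdiff.2 ⟨hiB, hiF⟩),
          hprod_of_notMem _ (Finset.notMem_erase _ _), Pi.add_apply, Pi.single_eq_same]
        ring
      · rw [hprod_of_notMem _ (fun h => hiB (Finset.mem_sdiff.1 h).1), add_zero]

theorem mem_lawrencePolytope_iff {x : Fin d → ℝ} {y : Fin n → ℝ} :
    (x, y) ∈ lawrencePolytope d n b ↔
      ∑ i, y i = 1 ∧ x ∈ relZonotope ⊥ (fun i => toR d (b i)) y := by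
  constructor
  · intro h
    have hconv : Convex ℝ {p : (Fin d → ℝ) × (Fin n → ℝ) |
        ∑ i, p.2 i = 1 ∧ p.1 ∈ relZonotope ⊥ (fun i => toR d (b i)) p.2} := by
      rintro ⟨x, y⟩ ⟨hy, t, ht, hx⟩ ⟨x', y'⟩ ⟨hy', t', ht', hx'⟩ p q hp hq hpq
      refine ⟨?_, p • t + q • t', fun i => ⟨?_, ?_⟩, ?_⟩
      · simp only [Prod.smul_mk, Prod.mk_add_mk, Pi.add_apply, Pi.smul_apply, smul_eq_mul,
          Finset.sum_add_distrib, ← Finset.mul_sum]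
        simp only at hy hy'
        rw [hy, hy', mul_one, mul_one, hpq]
      · exact add_nonneg (mul_nonneg hp (ht i).1) (mul_nonneg hq (ht' i).1)
      · exact add_le_add (mul_le_mul_of_nonneg_left (ht i).2 hp)
          (mul_le_mul_of_nonneg_left (ht' i).2 hq)
      · have := add_mem (Submodule.smul_mem _ p hx) (Submodule.smul_mem _ q hx')
        convert this using 1
        simp only [Prod.smul_mk, Prod.mk_add_mk, Pi.add_apply, Pi.smul_apply, smul_eq_mul,
          add_smul, mul_smul, Finset.sum_add_distrib, ← Finset.smul_sum, smul_sub]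
        abel
    refine convexHull_min ?_ hconv h
    rintro _ (⟨i, rfl⟩ | ⟨i, rfl⟩)
    · refine ⟨by simp [e], Pi.single i 1, fun j => ⟨?_, le_rfl⟩, ?_⟩
      · rcases eq_or_ne j i with rfl | hj <;> simp [*]
      · rw [Finset.sum_eq_single i (fun j _ hj => by simp [hj]) (by simp)]
        simp
    · refine ⟨by simp [e], 0, fun j => ⟨le_rfl, ?_⟩, by simp⟩
      rcases eq_or_ne j i with rfl | hj <;> simp [e, *]
  · rintro ⟨hy, t, ht, hx⟩
    rw [Submodule.mem_bot, sub_eq_zero] at hx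
    have h := (convex_convexHull ℝ ((Set.range fun i => (toR d (b i), e n i)) ∪
      (Set.range fun i => ((0 : Fin d → ℝ), e n i)))).sum_mem (t := Finset.univ)
      (w := Sum.elim t (y - t))
      (z := Sum.elim (fun i => (toR d (b i), e n i)) (fun i => (0, e n i)))
      (by
        rintro (i | i) -
        · exact (ht i).1
        · exact sub_nonneg.2 (ht i).2)
      (by simp [Fintype.sum_sum_type, hy])
      (by
        rintro (i | i) -
        · exact subset_convexHull ℝ _ (Or.inl ⟨i, rfl⟩)
        · exact subset_convexHull ℝ _ (Or.inr ⟨i, rfl⟩))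
    rw [lawrencePolytope]
    convert h using 1
    refine Prod.ext ?_ ?_
    · simp [Fintype.sum_sum_type, Prod.fst_sum, hx]
    · ext j
      simp [Fintype.sum_sum_type, Prod.snd_sum, e, Finset.sum_apply, Pi.single_apply]

theorem mem_smul_lawrencePolytope_iff (hn : 0 < n) {m : ℕ} {x : Fin d → ℝ} {y : Fin n → ℝ} :
    (x, y) ∈ (m : ℝ) • lawrencePolytope d n b ↔
      ∑ i, y i = m ∧ x ∈ relZonotope ⊥ (fun i => toR d (b i)) y := by
  rcases Nat.eq_zero_or_pos m with rfl | hm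
  · have hne : (lawrencePolytope d n b).Nonempty :=
      ⟨_, subset_convexHull ℝ _ (Or.inr ⟨⟨0, hn⟩, rfl⟩)⟩
    rw [Nat.cast_zero, Set.zero_smul_set hne, Set.mem_zero, Prod.mk_eq_zero]
    constructor
    · rintro ⟨rfl, rfl⟩
      exact ⟨by simp, 0, by simp, by simp⟩
    · rintro ⟨hy, t, ht, hx⟩
      have hy0 : y = 0 := funext fun i =>
        (Finset.sum_eq_zero_iff_of_nonneg fun i _ => (ht i).1.trans (ht i).2).1 hy i
          (Finset.mem_univ i)
      subst hy0
      have ht0 : t = 0 := funext fun i => le_antisymm (ht i).2 (ht i).1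
      exact ⟨by simpa [ht0] using hx, rfl⟩
  · have hm0 : (0 : ℝ) < m := Nat.cast_pos.2 hm
    rw [Set.mem_smul_set_iff_inv_smul_mem₀ hm0.ne', Prod.smul_mk, mem_lawrencePolytope_iff]
    refine and_congr ?_ ?_
    · simp only [Pi.smul_apply, smul_eq_mul, ← Finset.mul_sum]
      rw [inv_mul_eq_iff_eq_mul₀ hm0.ne', mul_one]
    · constructor
      · rintro ⟨t, ht, hx⟩
        refine ⟨(m : ℝ) • t, fun i => ⟨mul_nonneg hm0.le (ht i).1, ?_⟩, ?_⟩
        · have := mul_le_mul_of_nonneg_left (ht i).2 hm0.le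
          simpa [hm0.ne'] using this
        · have := Submodule.smul_mem _ (m : ℝ) hx
          simpa [smul_sub, Finset.smul_sum, smul_smul, hm0.ne'] using this
      · rintro ⟨t, ht, hx⟩
        refine ⟨(m : ℝ)⁻¹ • t, fun i => ⟨mul_nonneg (inv_nonneg.2 hm0.le) (ht i).1,
          mul_le_mul_of_nonneg_left (ht i).2 (inv_nonneg.2 hm0.le)⟩, ?_⟩
        have := Submodule.smul_mem _ (m : ℝ)⁻¹ hx
        simpa only [smul_sub, Finset.smul_sum, smul_smul, Pi.smul_apply, smul_eq_mul] using this

theorem memMatroid_empty : memMatroid d n b ∅ := by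
  rw [memMatroid_iff_linearIndepOn, Finset.coe_empty]
  exact linearIndepOn_empty ℝ _

/-- The lattice points of a zonotope with integer dilation factors, counted by
independent sets. -/
theorem ncard_lattice_zonotope (a : Fin n → ℕ) :
    {z : Fin d → ℤ | toR d z ∈ relZonotope ⊥ (fun i => toR d (b i)) fun i => (a i : ℝ)}.Finite ∧
    {z : Fin d → ℤ |
      toR d z ∈ relZonotope ⊥ (fun i => toR d (b i)) fun i => (a i : ℝ)}.ncard =
        ∑ B : Finset (Fin n) with memMatroid d n b B, latticeIndex b B * ∏ i ∈ B, a i := by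
  have h := ncard_zonotopeClasses a (memMatroid_empty (d := d) (b := b))
  have hW : spanF d n b ∅ = ⊥ := by simp [spanF]
  have hinj : Set.InjOn (QuotientAddGroup.mk : _ → (Fin d → ℤ) ⧸ latticeF b ∅)
      {z : Fin d → ℤ |
        toR d z ∈ relZonotope ⊥ (fun i => toR d (b i)) fun i => (a i : ℝ)} := by
    intro x _ y _ hxy
    have := QuotientAddGroup.eq.1 hxy
    simp only [latticeF, Finset.coe_empty, Set.image_empty, AddSubgroup.closure_empty,
      AddSubgroup.mem_bot] at this
    exact neg_add_eq_zero.1 this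
  simp only [Finset.empty_subset, true_and, Finset.sdiff_empty] at h
  rw [← h.2, hW]
  exact ⟨((Set.finite_image_iff hinj).1 (by rw [hW] at h; exact h.1)), hinj.ncard_image.symm⟩

theorem latticeCount_lawrencePolytope (hn : 0 < n) (m : ℕ) :
    latticeCount d n (lawrencePolytope d n b) m =
      ∑ B : Finset (Fin n) with memMatroid d n b B, latticeIndex b B *
        ∑ l ∈ (Finset.univ : Finset (Fin n)).finsuppAntidiag m, ∏ i ∈ B, l i := by
  let K : (Fin n →₀ ℕ) → Set (Fin d → ℤ) := fun l =>
    {z | toR d z ∈ relZonotope ⊥ (fun i => toR d (b i)) fun i => (l i : ℝ)}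
  let ψ : (Fin n →₀ ℕ) → (Fin d → ℤ) → (Fin d → ℤ) × (Fin n → ℤ) :=
    fun l z => (z, fun i => (l i : ℤ))
  have hψ : ∀ l, Function.Injective (ψ l) := fun l z z' h => congrArg Prod.fst h
  have hunion : {z : (Fin d → ℤ) × (Fin n → ℤ) |
      (toR d z.1, fun j => (z.2 j : ℝ)) ∈ (m : ℝ) • lawrencePolytope d n b} =
      ⋃ l ∈ ((Finset.univ : Finset (Fin n)).finsuppAntidiag m : Set (Fin n →₀ ℕ)),
        ψ l '' K l := by
    ext ⟨x, y⟩
    simp only [Set.mem_ofPred_eq, mem_smul_lawrencePolytope_iff hn, Set.mem_iUnion,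
      Finset.mem_coe, Finset.mem_finsuppAntidiag, exists_prop]
    constructor
    · rintro ⟨hy, hx⟩
      have hy0 : ∀ i, 0 ≤ y i := by
        obtain ⟨t, ht, -⟩ := hx
        intro i
        have : (0 : ℝ) ≤ y i := (ht i).1.trans (ht i).2
        exact_mod_cast this
      have hcast : ∀ i, (((y i).toNat : ℕ) : ℤ) = y i := fun i => Int.toNat_of_nonneg (hy0 i)
      have hcast' : ∀ i, (((y i).toNat : ℕ) : ℝ) = y i := fun i => by
        exact_mod_cast congrArg (Int.cast (R := ℝ)) (hcast i)
      refine ⟨Finsupp.equivFunOnFinite.symm fun i => (y i).toNat,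
        ⟨?_, Finset.subset_univ _⟩, x, ?_, ?_⟩
      · have : ((∑ i, (y i).toNat : ℕ) : ℝ) = m := by
          rw [← hy, Nat.cast_sum]
          exact Finset.sum_congr rfl fun i _ => hcast' i
        exact_mod_cast this
      · simpa only [K, Set.mem_ofPred_eq, Finsupp.equivFunOnFinite_symm_apply_apply, hcast']
          using hx
      · exact Prod.ext rfl (funext hcast)
    · rintro ⟨l, ⟨hl, -⟩, z, hz, hzxy⟩
      obtain ⟨rfl, rfl⟩ := Prod.mk_inj.1 hzxy
      refine ⟨?_, by simpa [K] using hz⟩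
      rw [← hl]
      simp
  have hfin : ∀ l ∈ (Finset.univ : Finset (Fin n)).finsuppAntidiag m, (ψ l '' K l).Finite :=
    fun l _ => (ncard_lattice_zonotope (b := b) l).1.image _
  have hdisj : ((Finset.univ : Finset (Fin n)).finsuppAntidiag m :
      Set (Fin n →₀ ℕ)).PairwiseDisjoint fun l => ψ l '' K l := by
    intro l _ l' _ hne
    refine Set.disjoint_left.2 ?_
    rintro _ ⟨z, -, rfl⟩ ⟨z', -, h⟩
    refine hne (Finsupp.ext fun i => ?_)
    have := congrFun (congrArg Prod.snd h) i
    exact (Nat.cast_injective this).symm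
  rw [latticeCount, Nat.card_coe_set_eq, hunion,
    Set.Finite.ncard_biUnion (Finset.finite_toSet _) hfin hdisj, finsum_mem_coe_finset]
  simp only [Set.ncard_image_of_injective _ (hψ _), Finset.mul_sum]
  rw [Finset.sum_comm]
  exact Finset.sum_congr rfl fun l _ => (ncard_lattice_zonotope (b := b) l).2

theorem one_sub_X_sq_mul_mk_natCast :
    (1 - PowerSeries.X) ^ 2 * PowerSeries.mk (fun k => (k : ℤ)) = PowerSeries.X := by
  have h : PowerSeries.mk (fun k => (k : ℤ)) * (1 - PowerSeries.X) =
      PowerSeries.X * PowerSeries.mk 1 := by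
    ext k
    rw [mul_sub, mul_one, map_sub]
    cases k with
    | zero => simp
    | succ k => simp [PowerSeries.coeff_succ_mul_X, PowerSeries.coeff_succ_X_mul]
  calc (1 - PowerSeries.X) ^ 2 * PowerSeries.mk (fun k => (k : ℤ))
      = PowerSeries.mk (fun k => (k : ℤ)) * (1 - PowerSeries.X) * (1 - PowerSeries.X) := by ring
    _ = PowerSeries.X := by
        rw [h, mul_assoc, PowerSeries.mk_one_mul_one_sub_eq_one, mul_one]

/-- The generating function of the sums of the monomial of `B` over all compositions. -/
theorem one_sub_X_pow_mul_mk_sum_prod {B : Finset (Fin n)} (hB : B.card ≤ d) :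
    (1 - PowerSeries.X) ^ (n + d) * PowerSeries.mk (fun m =>
      ∑ l ∈ (Finset.univ : Finset (Fin n)).finsuppAntidiag m, ∏ i ∈ B, (l i : ℤ)) =
        PowerSeries.X ^ B.card * (1 - PowerSeries.X) ^ (d - B.card) := by
  have hmk : PowerSeries.mk (fun m =>
      ∑ l ∈ (Finset.univ : Finset (Fin n)).finsuppAntidiag m, ∏ i ∈ B, (l i : ℤ)) =
      ∏ i, if i ∈ B then PowerSeries.mk (fun k => (k : ℤ)) else PowerSeries.mk 1 := by
    ext m
    rw [PowerSeries.coeff_mk, PowerSeries.coeff_prod]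
    refine Finset.sum_congr rfl fun l _ => ?_
    rw [← Finset.prod_subset (Finset.subset_univ B) (fun i _ hi => by simp [hi])]
    exact Finset.prod_congr rfl fun i hi => by simp [hi]
  have hpow : ((1 - PowerSeries.X) ^ (n + d) : PowerSeries ℤ) =
      (1 - PowerSeries.X) ^ (d - B.card) *
        ∏ i, if i ∈ B then (1 - PowerSeries.X) ^ 2 else (1 - PowerSeries.X) := by
    have hcard := Finset.card_compl B
    have hle := Finset.card_le_univ B
    rw [Fintype.card_fin] at hcard hle
    rw [Finset.prod_ite, Finset.prod_const, Finset.prod_const, ← pow_mul,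
      Finset.filter_univ_mem, Finset.filter_notMem_eq_sdiff, ← Finset.compl_eq_univ_sdiff, hcard,
      ← pow_add, ← pow_add]
    congr 1
    omega
  rw [hmk, hpow, mul_assoc, ← Finset.prod_mul_distrib, mul_comm]
  congr 1
  calc _ = ∏ i : Fin n, if i ∈ B then (PowerSeries.X : PowerSeries ℤ) else 1 :=
        Finset.prod_congr rfl fun i _ => by
          split_ifs
          · exact one_sub_X_sq_mul_mk_natCast
          · rw [mul_comm, PowerSeries.mk_one_mul_one_sub_eq_one]
    _ = _ := by simp

theorem memMatroid.card_le {B : Finset (Fin n)} (hB : memMatroid d n b B) : B.card ≤ d := by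
  have := LinearIndependent.fintype_card_le_finrank hB
  simpa using this

theorem eq_of_isDeltaPoly (hn : 0 < n) {δ : Polynomial ℤ}
    (hδ : IsDeltaPoly d n (lawrencePolytope d n b) δ) :
    δ = ∑ B : Finset (Fin n) with memMatroid d n b B,
      C (latticeIndex b B : ℤ) * (X ^ B.card * (1 - X) ^ (d - B.card)) := by
  refine Polynomial.coe_injective ℤ ?_
  have hmk : PowerSeries.mk (fun m => (latticeCount d n (lawrencePolytope d n b) m : ℤ)) =
      ∑ B : Finset (Fin n) with memMatroid d n b B, PowerSeries.C (latticeIndex b B : ℤ) *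
        PowerSeries.mk (fun m => ∑ l ∈ (Finset.univ : Finset (Fin n)).finsuppAntidiag m,
          ∏ i ∈ B, (l i : ℤ)) := by
    ext m
    simp only [latticeCount_lawrencePolytope hn, map_sum, PowerSeries.coeff_mk,
      PowerSeries.coeff_C_mul, Nat.cast_sum, Nat.cast_mul, Nat.cast_prod]
  rw [← hδ.2, hmk, Finset.mul_sum, ← Polynomial.coeToPowerSeries.ringHom_apply, map_sum]
  refine Finset.sum_congr rfl fun B hB => ?_
  rw [mul_left_comm, one_sub_X_pow_mul_mk_sum_prod (Finset.mem_filter.1 hB).2.card_le]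
  simp only [Polynomial.coeToPowerSeries.ringHom_apply, Polynomial.coe_mul, Polynomial.coe_C,
    Polynomial.coe_pow, Polynomial.coe_X, Polynomial.coe_sub, Polynomial.coe_one]

theorem memMatroid.dimF_eq {F : Finset (Fin n)} (hF : memMatroid d n b F) :
    dimF d n b F = F.card := by
  have h := finrank_span_eq_card hF
  rw [Fintype.card_coe] at h
  rw [dimF, spanF, ← h, Set.image_eq_range]
  rfl

theorem memMatroidRes.dimRes_eq {F G : Finset (Fin n)} (h : memMatroidRes d n b F G) :
    dimRes d n b F G = G.card := by
  have h' := finrank_span_eq_card h.2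
  rw [Fintype.card_coe] at h'
  rw [dimRes, ← h', Set.image_eq_range]
  rfl

theorem memMatroidRes_iff {F G : Finset (Fin n)} (hF : memMatroid d n b F) :
    memMatroidRes d n b F G ↔ Disjoint F G ∧ memMatroid d n b (F ∪ G) := by
  rw [memMatroid_iff_linearIndepOn, Finset.coe_union]
  constructor
  · rintro ⟨hG, hli⟩
    have hdisj : Disjoint F G := Finset.disjoint_left.2 fun i hiF hiG =>
      hG i hiG (Submodule.subset_span ⟨i, hiF, rfl⟩)
    exact ⟨hdisj, (LinearIndepOn.quotient_iff_union (memMatroid_iff_linearIndepOn.1 hF)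
      (Finset.disjoint_coe.2 hdisj)).1 hli⟩
  · rintro ⟨hdisj, hli⟩
    refine ⟨fun i hi hmem => ?_, (LinearIndepOn.quotient_iff_union
      (memMatroid_iff_linearIndepOn.1 hF) (Finset.disjoint_coe.2 hdisj)).2 hli⟩
    have hiF : i ∉ F := Finset.disjoint_right.1 hdisj hi
    have := hli.mono (t := insert i (F : Set (Fin n)))
      (Set.insert_subset (Or.inr hi) Set.subset_union_left)
    exact ((linearIndepOn_insert (by simpa using hiF)).1 this).2 hmem

/-- The top-dimensional elements of `M_F` correspond to the bases containing `F`. -/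
theorem fRes_codim {F : Finset (Fin n)} (hF : memMatroid d n b F) :
    fRes d n b F (d - dimF d n b F) =
      (Finset.univ.filter fun B : Finset (Fin n) =>
        (memMatroid d n b B ∧ B.card = d) ∧ F ⊆ B).card := by
  have hcard := hF.card_le
  rw [fRes, hF.dimF_eq, Nat.card_eq_card_toFinset]
  refine Finset.card_bij' (fun G _ => F ∪ G) (fun B _ => B \ F) ?_ ?_ ?_ ?_
  · intro G hG
    obtain ⟨hres, hdim⟩ := Set.mem_toFinset.1 hG
    obtain ⟨hdisj, hli⟩ := (memMatroidRes_iff hF).1 hres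
    rw [hres.dimRes_eq] at hdim
    refine Finset.mem_filter.2 ⟨Finset.mem_univ _, ⟨hli, ?_⟩, Finset.subset_union_left⟩
    rw [Finset.card_union_of_disjoint hdisj]
    omega
  · intro B hB
    obtain ⟨-, ⟨hB, hBd⟩, hFB⟩ := Finset.mem_filter.1 hB
    have hres : memMatroidRes d n b F (B \ F) :=
      (memMatroidRes_iff hF).2 ⟨Finset.disjoint_sdiff,
        by rwa [Finset.union_sdiff_of_subset hFB]⟩
    refine Set.mem_toFinset.2 ⟨hres, ?_⟩
    rw [hres.dimRes_eq, Finset.card_sdiff_of_subset hFB, hBd]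
  · intro G hG
    have hdisj := ((memMatroidRes_iff hF).1 (Set.mem_toFinset.1 hG).1).1
    exact Finset.union_sdiff_cancel_left hdisj
  · intro B hB
    exact Finset.union_sdiff_of_subset (Finset.mem_filter.1 hB).2.2

end Lawrence

/-- `δ_B(1) = Σ_{F ∈ M_B} #(BOX(F) ∩ ℤ^d) V_F`. -/
theorem statement5 (d n : ℕ) (hd : 0 < d) (hn : 0 < n)
    (b : Fin n → Fin d → ℤ) (hb : ∀ i, b i ≠ 0)
    (hgen : Submodule.span ℤ (Set.range b) = ⊤)
    (δ : Polynomial ℤ) (hδ : IsDeltaPoly d n (lawrencePolytope d n b) δ) :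
    δ.eval 1 = ∑ F : Finset (Fin n),
      if memMatroid d n b F then
        (boxCount d n b F : ℤ) * fRes d n b F (d - dimF d n b F)
      else 0 := by
  have hδ1 : δ.eval 1 = ∑ B : Finset (Fin n) with memMatroid d n b B ∧ B.card = d,
      (latticeIndex b B : ℤ) := by
    rw [eq_of_isDeltaPoly hn hδ, Polynomial.eval_finsetSum, ← Finset.filter_filter,
      Finset.sum_filter (fun B : Finset (Fin n) => B.card = d)]
    refine Finset.sum_congr rfl fun B hB => ?_
    have hcard := (Finset.mem_filter.1 hB).2.card_le
    split_ifs with h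
    · simp [h]
    · have : d - B.card ≠ 0 := by omega
      simp [this]
  rw [hδ1]
  calc ∑ B : Finset (Fin n) with memMatroid d n b B ∧ B.card = d, (latticeIndex b B : ℤ)
      = ∑ B : Finset (Fin n) with memMatroid d n b B ∧ B.card = d, ∑ F : Finset (Fin n),
          if F ⊆ B then (boxCount d n b F : ℤ) else 0 := by
        refine Finset.sum_congr rfl fun B hB => ?_
        rw [latticeIndex_eq_sum_boxCount (Finset.mem_filter.1 hB).2.1, Nat.cast_sum,
          ← Finset.sum_filter]
        refine Finset.sum_congr ?_ fun _ _ => rfl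
        ext F
        simp
    _ = _ := by
        rw [Finset.sum_comm]
        refine Finset.sum_congr rfl fun F _ => ?_
        rw [← Finset.sum_filter, Finset.sum_const, Finset.filter_filter]
        split_ifs with hF
        · rw [fRes_codim hF, nsmul_eq_mul, mul_comm]
        · rw [Finset.filter_eq_empty_iff.2, Finset.card_empty, zero_smul]
          rintro B - ⟨⟨hB, -⟩, hFB⟩
          exact hF (hB.subset hFB)

end LawrencePaper
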